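/- Let w = (w_1, …, w_r) be any finite nonempty word in the letters {T, R}, and for each j ≥ 0 let (X, v^{(j)}) be the state obtained by applying the operators w_r ∘ ⋯ ∘ w_1 to the initial state (UP, e_0) in F^{j+1} (the resulting type X ∈ {UP, OP, RI} is the same for all j). Then there exist integers m, n ≥ 0 with m + n ≥ 1, a symmetric matrix Q ∈ M_{m+n}(ℤ), and vectors S, A ∈ ℤ^{m+n} such that for all integers 0 ≤ k ≤ j: v^{(j)}_k · [j; k]_+ = ∑ (−q)^{S·d} a^{A·d} q^{dᵀQd} [j; d_1, …, d_{m+n}], where the sum is over all d ∈ ℕ^{m+n} with d_1 + ⋯ + d_{m+n} = j and d_1 + ⋯ + d_m = k. (This says the generating function of the rescaled HOMFLY-PT skein evaluations of every rational tangle can be written in quiver form.) -/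

import Mathlib

noncomputable section

open Finset

/-- The field `ℚ(q, a)` of rational functions in two variables. -/
abbrev F : Type := FractionRing (MvPolynomial (Fin 2) ℚ)

/-- The variable `q`. -/
def q : F := algebraMap (MvPolynomial (Fin 2) ℚ) F (MvPolynomial.X 0)

/-- The variable `a`. -/
def a : F := algebraMap (MvPolynomial (Fin 2) ℚ) F (MvPolynomial.X 1)

/-- The q-Pochhammer symbol `(x; y)_n = ∏_{j=0}^{n-1} (1 - x yʲ)`. -/
def qPoch (x y : F) (n : ℕ) : F := ∏ i ∈ Finset.range n, (1 - x * y ^ i)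

/-- `(q²;q²)_m = ∏_{i=1}^{m} (1 - q^{2i})`. -/
def qp (m : ℕ) : F := qPoch (q ^ 2) (q ^ 2) m

/-- The positive quantum binomial coefficient `[N; k]₊`. -/
def qbin (N k : ℕ) : F := qp N / (qp k * qp (N - k))

/-- Boundary orientation types of a 4-ended tangle. -/
inductive TangleType | UP | OP | RI
  deriving DecidableEq

/-- The two elementary twist operations: top twist `T` and right twist `R`. -/
inductive Letter | T | R
  deriving DecidableEq

/-- The boundary orientation type after applying one twist. -/
def typeStep : Letter → TangleType → TangleType
  | Letter.T, TangleType.UP => TangleType.UP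
  | Letter.T, TangleType.OP => TangleType.RI
  | Letter.T, TangleType.RI => TangleType.OP
  | Letter.R, TangleType.UP => TangleType.OP
  | Letter.R, TangleType.OP => TangleType.UP
  | Letter.R, TangleType.RI => TangleType.RI

/-- The boundary orientation type after applying a word of twists. -/
def typeWord : List Letter → TangleType → TangleType
  | [], X => X
  | l :: w, X => typeWord w (typeStep l X)

/-- The coefficient of the basis web `e_h` in the twist `l` applied to `(X, e_k)`,
for the `j`-colored HOMFLY-PT skein twist rules. -/
def coef (l : Letter) (X : TangleType) (j k h : ℕ) : F :=
  match l, X with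
  | Letter.T, TangleType.UP =>
      if k ≤ h ∧ h ≤ j then
        (-q) ^ ((h : ℤ) - (j : ℤ)) * q ^ ((k : ℤ) ^ 2) * qbin h k
      else 0
  | Letter.T, TangleType.OP =>
      if k ≤ h ∧ h ≤ j then
        (-q) ^ (h : ℤ) * a ^ (k : ℤ) *
          q ^ ((k : ℤ) ^ 2 - 2 * (j : ℤ) * (k : ℤ)) * qbin h k
      else 0
  | Letter.T, TangleType.RI =>
      if k ≤ h ∧ h ≤ j then
        (-q) ^ (h : ℤ) * a ^ (h : ℤ) *
          q ^ ((k : ℤ) ^ 2 - 2 * (j : ℤ) * (h : ℤ)) * qbin h k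
      else 0
  | Letter.R, TangleType.UP =>
      if h ≤ k then
        (-q) ^ ((h : ℤ) - (j : ℤ)) * a ^ ((h : ℤ) - (j : ℤ)) *
          q ^ (-2 * (k : ℤ) * (h : ℤ) + (k : ℤ) ^ 2 + (j : ℤ) ^ 2) * qbin (j - h) (k - h)
      else 0
  | Letter.R, TangleType.OP =>
      if h ≤ k then
        (-q) ^ ((h : ℤ) - (j : ℤ)) * a ^ ((k : ℤ) - (j : ℤ)) *
          q ^ (2 * (h : ℤ) * ((j : ℤ) - (k : ℤ)) + ((k : ℤ) - (j : ℤ)) ^ 2) *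
          qbin (j - h) (k - h)
      else 0
  | Letter.R, TangleType.RI =>
      if h ≤ k then
        (-q) ^ (h : ℤ) *
          q ^ ((h : ℤ) * (2 * (j : ℤ) - 2 * (k : ℤ)) + (k : ℤ) ^ 2 - (j : ℤ) ^ 2) *
          qbin (j - h) (k - h)
      else 0

/-- One twist applied (F-linearly) to the vector part of a state in `F^{j+1}`. -/
def stepVec (l : Letter) (X : TangleType) (j : ℕ) (v : Fin (j + 1) → F) :
    Fin (j + 1) → F :=
  fun h => ∑ k : Fin (j + 1), v k * coef l X j (k : ℕ) (h : ℕ)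

/-- The vector part of the state obtained by applying a word of twists to `(X, v)`. -/
def runVec : List Letter → TangleType → (j : ℕ) → (Fin (j + 1) → F) → (Fin (j + 1) → F)
  | [], _, _, v => v
  | l :: w, X, j, v => runVec w (typeStep l X) j (stepVec l X j v)

/-- The initial vector `e_0` (the trivial tangle). -/
def e0 (j : ℕ) : Fin (j + 1) → F := fun k => if (k : ℕ) = 0 then 1 else 0

theorem q_ne_zero : q ≠ 0 := by
  simp [q]

theorem a_ne_zero : a ≠ 0 := by
  simp [a]

theorem qp_ne_zero (m : ℕ) : qp m ≠ 0 := by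
  rw [qp, qPoch, prod_ne_zero_iff]
  intro i _ h
  have hpow : q ^ (2 + 2 * i) = 1 := by linear_combination -h
  rw [q, ← map_pow, ← map_one (algebraMap (MvPolynomial (Fin 2) ℚ) F)] at hpow
  have h0 := congrArg (MvPolynomial.eval fun _ => (0 : ℚ))
    (IsFractionRing.injective (MvPolynomial (Fin 2) ℚ) F hpow)
  simp at h0

theorem qp_succ (m : ℕ) : qp (m + 1) = qp m * (1 - (q ^ 2) ^ (m + 1)) := by
  rw [qp, qp, qPoch, qPoch, prod_range_succ, ← pow_succ']

theorem one_sub_ne_zero (m : ℕ) : 1 - (q ^ 2) ^ (m + 1) ≠ 0 := by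
  have h := qp_ne_zero (m + 1)
  rw [qp_succ] at h
  exact right_ne_zero_of_mul h

/-- A function on an abelian group of the form
`x ↦ (-q) ^ S(x) * a ^ A(x) * q ^ B(x, x)` with `S`, `A` linear and `B` symmetric bilinear. -/
def IsQuadraticWeight {M : Type*} [AddCommGroup M] (W : M → F) : Prop :=
  ∃ (S A : M →ₗ[ℤ] ℤ) (B : M →ₗ[ℤ] M →ₗ[ℤ] ℤ), (∀ x y, B x y = B y x) ∧
    ∀ x, W x = (-q) ^ S x * a ^ A x * q ^ B x x

namespace IsQuadraticWeight

variable {M N : Type*} [AddCommGroup M] [AddCommGroup N]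

theorem mul {W V : M → F} (hW : IsQuadraticWeight W) (hV : IsQuadraticWeight V) :
    IsQuadraticWeight fun x => W x * V x := by
  obtain ⟨S, A, B, hB, h⟩ := hW
  obtain ⟨S', A', B', hB', h'⟩ := hV
  refine ⟨S + S', A + A', B + B', fun x y => by simp [hB x y, hB' x y], fun x => ?_⟩
  simp only [h, h', LinearMap.add_apply, zpow_add₀ q_ne_zero, zpow_add₀ a_ne_zero,
    zpow_add₀ (neg_ne_zero.mpr q_ne_zero)]
  ring

theorem inv {W : M → F} (hW : IsQuadraticWeight W) : IsQuadraticWeight fun x => (W x)⁻¹ := by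
  obtain ⟨S, A, B, hB, h⟩ := hW
  refine ⟨-S, -A, -B, fun x y => by simp [hB x y], fun x => ?_⟩
  simp only [h, LinearMap.neg_apply, zpow_neg, mul_inv]

theorem comp {W : N → F} (hW : IsQuadraticWeight W) (L : M →ₗ[ℤ] N) :
    IsQuadraticWeight fun x => W (L x) := by
  obtain ⟨S, A, B, hB, h⟩ := hW
  exact ⟨S ∘ₗ L, A ∘ₗ L, B.compl₁₂ L L, fun x y => by simp [hB (L x)], fun x => by simp [h]⟩

theorem one : IsQuadraticWeight fun _ : M => (1 : F) :=
  ⟨0, 0, 0, fun _ _ => rfl, fun x => by simp⟩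

theorem neg_q_zpow (S : M →ₗ[ℤ] ℤ) : IsQuadraticWeight fun x => (-q) ^ S x :=
  ⟨S, 0, 0, fun _ _ => rfl, fun x => by simp⟩

theorem a_zpow (A : M →ₗ[ℤ] ℤ) : IsQuadraticWeight fun x => a ^ A x :=
  ⟨0, A, 0, fun _ _ => rfl, fun x => by simp⟩

theorem q_zpow_sq (S : M →ₗ[ℤ] ℤ) : IsQuadraticWeight fun x => q ^ (S x ^ 2) :=
  ⟨0, 0, (LinearMap.mul ℤ ℤ).compl₁₂ S S, fun x y => by simp [mul_comm],
    fun x => by simp [sq]⟩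

theorem q_zpow_two_mul (S T : M →ₗ[ℤ] ℤ) :
    IsQuadraticWeight fun x => q ^ (2 * (S x * T x)) :=
  ⟨0, 0, (LinearMap.mul ℤ ℤ).compl₁₂ S T + (LinearMap.mul ℤ ℤ).compl₁₂ T S,
    fun x y => by simp; ring, fun x => by simp; ring_nf⟩

theorem prod {ι : Type*} (s : Finset ι) {W : ι → M → F}
    (hW : ∀ i, IsQuadraticWeight (W i)) : IsQuadraticWeight fun x => ∏ i ∈ s, W i x := by
  classical
  induction s using Finset.induction with
  | empty => simpa using one
  | insert i s hi ih =>
    simp only [prod_insert hi]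
    exact (hW i).mul ih

end IsQuadraticWeight

/-- The twist coefficients without their quantum binomial factors are quadratic weights in
`(j, k, h)`. -/
theorem exists_weight_coef_T (X : TangleType) :
    ∃ C : ℤ × ℤ × ℤ → F, IsQuadraticWeight C ∧ ∀ j k h : ℕ,
      coef Letter.T X j k h = if k ≤ h ∧ h ≤ j then C (j, k, h) * qbin h k else 0 := by
  let J : ℤ × ℤ × ℤ →ₗ[ℤ] ℤ := LinearMap.fst ℤ ℤ (ℤ × ℤ)
  let K : ℤ × ℤ × ℤ →ₗ[ℤ] ℤ := LinearMap.fst ℤ ℤ ℤ ∘ₗ LinearMap.snd ℤ ℤ (ℤ × ℤ)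
  let H : ℤ × ℤ × ℤ →ₗ[ℤ] ℤ := LinearMap.snd ℤ ℤ ℤ ∘ₗ LinearMap.snd ℤ ℤ (ℤ × ℤ)
  cases X
  · exact ⟨_, (IsQuadraticWeight.neg_q_zpow (H - J)).mul (.q_zpow_sq K), fun j k h => rfl⟩
  · refine ⟨_, ((IsQuadraticWeight.neg_q_zpow H).mul (.a_zpow K)).mul
      ((IsQuadraticWeight.q_zpow_sq K).mul (.q_zpow_two_mul (-J) K)), fun j k h => ?_⟩
    simp only [coef, J, K, H, ← zpow_add₀ q_ne_zero]
    simp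
    ring_nf
  · refine ⟨_, ((IsQuadraticWeight.neg_q_zpow H).mul (.a_zpow H)).mul
      ((IsQuadraticWeight.q_zpow_sq K).mul (.q_zpow_two_mul (-J) H)), fun j k h => ?_⟩
    simp only [coef, J, K, H, ← zpow_add₀ q_ne_zero]
    simp
    ring_nf

theorem exists_weight_coef_R (X : TangleType) :
    ∃ C : ℤ × ℤ × ℤ → F, IsQuadraticWeight C ∧ ∀ j k h : ℕ,
      coef Letter.R X j k h = if h ≤ k then C (j, k, h) * qbin (j - h) (k - h) else 0 := by
  let J : ℤ × ℤ × ℤ →ₗ[ℤ] ℤ := LinearMap.fst ℤ ℤ (ℤ × ℤ)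
  let K : ℤ × ℤ × ℤ →ₗ[ℤ] ℤ := LinearMap.fst ℤ ℤ ℤ ∘ₗ LinearMap.snd ℤ ℤ (ℤ × ℤ)
  let H : ℤ × ℤ × ℤ →ₗ[ℤ] ℤ := LinearMap.snd ℤ ℤ ℤ ∘ₗ LinearMap.snd ℤ ℤ (ℤ × ℤ)
  cases X
  · refine ⟨_, ((IsQuadraticWeight.neg_q_zpow (H - J)).mul (.a_zpow (H - J))).mul
      (((IsQuadraticWeight.q_zpow_two_mul (-K) H).mul (.q_zpow_sq K)).mul (.q_zpow_sq J)),
      fun j k h => ?_⟩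
    simp only [coef, J, K, H, ← zpow_add₀ q_ne_zero]
    simp
    ring_nf
  · refine ⟨_, ((IsQuadraticWeight.neg_q_zpow (H - J)).mul (.a_zpow (K - J))).mul
      ((IsQuadraticWeight.q_zpow_two_mul H (J - K)).mul (.q_zpow_sq (K - J))),
      fun j k h => ?_⟩
    simp only [coef, J, K, H, ← zpow_add₀ q_ne_zero]
    simp
    ring_nf
  · refine ⟨_, (IsQuadraticWeight.neg_q_zpow H).mul
      (((IsQuadraticWeight.q_zpow_two_mul H (J - K)).mul (.q_zpow_sq K)).mul
        (IsQuadraticWeight.q_zpow_sq J).inv), fun j k h => ?_⟩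
    simp only [coef, J, K, H, ← zpow_add₀ q_ne_zero, ← zpow_neg]
    simp
    ring_nf
/-- The quantum binomial coefficient, extended by zero. -/
def gaussBinom (n k : ℕ) : F := if k ≤ n then qbin n k else 0

theorem gaussBinom_zero_right (n : ℕ) : gaussBinom n 0 = 1 := by
  have h := qp_ne_zero n
  have h0 : qp 0 = 1 := by simp [qp, qPoch]
  simp [gaussBinom, qbin, h0, h]

theorem gaussBinom_of_lt {n k : ℕ} (h : n < k) : gaussBinom n k = 0 :=
  if_neg (not_le.mpr h)

theorem gaussBinom_add (k l : ℕ) : gaussBinom (k + l) k = qp (k + l) / (qp k * qp l) := by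
  simp [gaussBinom, qbin]

theorem gaussBinom_succ_succ (n k : ℕ) :
    gaussBinom (n + 1) (k + 1) =
      gaussBinom n (k + 1) + q ^ (2 * ((n : ℤ) - k)) * gaussBinom n k := by
  rcases lt_trichotomy n k with h | rfl | h
  · rw [gaussBinom_of_lt h, gaussBinom_of_lt (by omega), gaussBinom_of_lt (by omega)]
    simp
  · have h := gaussBinom_add n 0
    have h' := gaussBinom_add (n + 1) 0
    have h0 : qp 0 = 1 := by simp [qp, qPoch]
    simp only [add_zero, h0, mul_one, div_self (qp_ne_zero _)] at h h'
    rw [h, h', gaussBinom_of_lt (by omega)]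
    simp
  · obtain ⟨l, rfl⟩ := Nat.exists_eq_add_of_lt h
    have e1 : k + l + 1 + 1 = (k + 1) + (l + 1) := by ring
    have e2 : k + l + 1 = (k + 1) + l := by ring
    have e3 : k + l + 1 = k + (l + 1) := by ring
    have e4 : (2 * (((k + l + 1 : ℕ) : ℤ) - k)) = ((2 * (l + 1) : ℕ) : ℤ) := by
      push_cast; ring
    rw [e4, zpow_natCast]
    nth_rewrite 3 [e3]
    rw [e1, gaussBinom_add, gaussBinom_add k (l + 1), e2, gaussBinom_add,
      show k + 1 + (l + 1) = (k + l + 1) + 1 by ring, ← e3, ← e2, qp_succ (k + l + 1),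
      qp_succ k, qp_succ l]
    have := qp_ne_zero k
    have := qp_ne_zero l
    have := one_sub_ne_zero k
    have := one_sub_ne_zero l
    field_simp
    ring

/-- The Gaussian product `∏_{i<n} (1 + c q^{2i} X)`. -/
def gaussProd (n : ℕ) (c : F) : Polynomial F :=
  ∏ i ∈ range n, (1 + Polynomial.C (c * (q ^ 2) ^ i) * Polynomial.X)

theorem gaussProd_add (n m : ℕ) (c : F) :
    gaussProd (n + m) c = gaussProd n c * gaussProd m (c * (q ^ 2) ^ n) := by
  simp only [gaussProd, prod_range_add, pow_add, mul_assoc]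

/-- The quantum binomial theorem. -/
theorem coeff_gaussProd (n k : ℕ) (c : F) :
    (gaussProd n c).coeff k = c ^ k * q ^ ((k : ℤ) ^ 2 - k) * gaussBinom n k := by
  induction n generalizing k with
  | zero =>
    cases k with
    | zero => simp [gaussProd, gaussBinom_zero_right]
    | succ k => simp [gaussProd, gaussBinom_of_lt, Polynomial.coeff_one]
  | succ n ih =>
    have hs : gaussProd (n + 1) c =
        gaussProd n c + Polynomial.C (c * (q ^ 2) ^ n) * (gaussProd n c * Polynomial.X) := by
      rw [gaussProd, prod_range_succ, ← gaussProd]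
      ring
    rw [hs, Polynomial.coeff_add, Polynomial.coeff_C_mul]
    cases k with
    | zero => simp [ih, gaussBinom_zero_right]
    | succ k =>
      rw [Polynomial.coeff_mul_X, ih, ih, gaussBinom_succ_succ]
      have e : (((k + 1 : ℕ) : ℤ) ^ 2 - ((k + 1 : ℕ) : ℤ)) + 2 * ((n : ℤ) - k) =
          ((2 * n : ℕ) : ℤ) + ((k : ℤ) ^ 2 - k) := by
        push_cast; ring
      have e' : q ^ (((k + 1 : ℕ) : ℤ) ^ 2 - ((k + 1 : ℕ) : ℤ)) * q ^ (2 * ((n : ℤ) - k)) =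
          (q ^ 2) ^ n * q ^ ((k : ℤ) ^ 2 - k) := by
        rw [← zpow_add₀ q_ne_zero, e, zpow_add₀ q_ne_zero, zpow_natCast, pow_mul]
      linear_combination (-c ^ (k + 1) * gaussBinom n k) * e'

theorem gaussProd_eq_sum (n : ℕ) (c : F) :
    gaussProd n c = ∑ p ∈ antidiagonal n,
      Polynomial.monomial p.1
        (c ^ p.1 * q ^ ((p.1 : ℤ) ^ 2 - p.1) * (qp n / (qp p.1 * qp p.2))) := by
  ext k
  rw [coeff_gaussProd, Polynomial.finsetSum_coeff]
  simp only [Polynomial.coeff_monomial]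
  by_cases h : k ≤ n
  · obtain ⟨l, rfl⟩ := Nat.exists_eq_add_of_le h
    rw [sum_eq_single (k, l)]
    · simp [gaussBinom_add]
    · rintro ⟨k', l'⟩ hp hne
      rw [if_neg]
      rintro rfl
      simp_all
    · simp
  · rw [gaussBinom_of_lt (by omega), mul_zero, sum_eq_zero]
    rintro ⟨k', l'⟩ hp
    rw [if_neg]
    rintro rfl
    simp at hp
    omega

theorem exists_gaussProd_sum_eq_prod {ι : Type*} [Fintype ι] [DecidableEq ι] (s : Finset ι) :
    ∃ O : ι → ι → ℕ, ∀ (x : ι → ℕ) (c : F),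
      gaussProd (∑ i ∈ s, x i) c =
        ∏ i ∈ s, gaussProd (x i) (c * (q ^ 2) ^ ∑ i', O i i' * x i') := by
  induction s using Finset.induction with
  | empty => exact ⟨0, by simp [gaussProd]⟩
  | insert b s hb ih =>
    obtain ⟨O, hO⟩ := ih
    refine ⟨Function.update O b fun i' => if i' ∈ s then 1 else 0, fun x c => ?_⟩
    rw [sum_insert hb, prod_insert hb, add_comm, gaussProd_add, hO, mul_comm]
    congr 1
    · simp
    · refine prod_congr rfl fun i hi => ?_
      rw [Function.update_of_ne (ne_of_mem_of_not_mem hi hb)]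

/-- The coordinatewise inclusion of natural vectors into integer vectors. -/
def natVec {ι : Type*} (x : ι → ℕ) : ι → ℤ := fun i => x i

/-- Sum of the coordinates. -/
def total (ι : Type*) [Fintype ι] : (ι → ℤ) →ₗ[ℤ] ℤ := ∑ i, LinearMap.proj i

theorem total_natVec {ι : Type*} [Fintype ι] (x : ι → ℕ) :
    total ι (natVec x) = ((∑ i, x i : ℕ) : ℤ) := by
  simp [total, natVec]

/-- The multi-variable quantum Vandermonde identity, with unspecified quadratic exponents. -/
theorem exists_vandermonde_weight (ι : Type*) [Fintype ι] [DecidableEq ι] :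
    ∃ V : (ι → ℤ) × (ι → ℤ) → F, IsQuadraticWeight V ∧ ∀ (x : ι → ℕ) (h : ℕ),
      gaussBinom (∑ i, x i) h / ∏ i, qp (x i) =
        ∑ p ∈ (Fintype.piFinset fun i => antidiagonal (x i)).filter
            (fun p => ∑ i, (p i).1 = h),
          V (natVec fun i => (p i).1, natVec fun i => (p i).2) /
            ((∏ i, qp (p i).1) * ∏ i, qp (p i).2) := by
  obtain ⟨O, hO⟩ := exists_gaussProd_sum_eq_prod (univ : Finset ι)
  let P : ι → (ι → ℤ) × (ι → ℤ) →ₗ[ℤ] ℤ :=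
    fun i => LinearMap.proj i ∘ₗ LinearMap.fst ℤ (ι → ℤ) (ι → ℤ)
  let Y : ι → (ι → ℤ) × (ι → ℤ) →ₗ[ℤ] ℤ :=
    fun i => ∑ i', (O i i' : ℤ) • (LinearMap.proj i' ∘ₗ LinearMap.fst ℤ (ι → ℤ) (ι → ℤ) +
      LinearMap.proj i' ∘ₗ LinearMap.snd ℤ (ι → ℤ) (ι → ℤ))
  refine ⟨_, (IsQuadraticWeight.prod univ fun i =>
    (IsQuadraticWeight.q_zpow_sq (P i)).mul (.q_zpow_two_mul (Y i) (P i))).mul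
      (IsQuadraticWeight.q_zpow_sq (total ι ∘ₗ LinearMap.fst ℤ (ι → ℤ) (ι → ℤ))).inv,
    fun x h => ?_⟩
  have key := congrArg (fun f => Polynomial.coeff f h) (hO x 1)
  rw [coeff_gaussProd] at key
  simp only [gaussProd_eq_sum, prod_univ_sum, one_pow, one_mul,
    Polynomial.finsetSum_coeff] at key
  have hmon : ∀ p : ι → ℕ × ℕ, ∀ f : ι → F,
      (∏ i, Polynomial.monomial (p i).1 (f i)).coeff h =
        if ∑ i, (p i).1 = h then ∏ i, f i else 0 := by
    intro p f
    rw [← Polynomial.coeff_monomial]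
    congr 1
    simp only [← Polynomial.C_mul_X_pow_eq_monomial, prod_mul_distrib, prod_pow_eq_pow_sum,
      map_prod]
  simp only [hmon, ← sum_filter] at key
  have hq : q ^ ((h : ℤ) ^ 2 - h) ≠ 0 := zpow_ne_zero _ q_ne_zero
  have hx : ∏ i, qp (x i) ≠ 0 := prod_ne_zero_iff.mpr fun i _ => qp_ne_zero _
  rw [div_eq_iff hx]
  refine mul_left_cancel₀ hq ?_
  rw [key, sum_mul, mul_sum]
  refine sum_congr rfl fun p hp => ?_
  simp only [mem_filter, Fintype.mem_piFinset, HasAntidiagonal.mem_antidiagonal] at hp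
  have hY : ∀ i, Y i (natVec fun i => (p i).1, natVec fun i => (p i).2) =
      ((∑ i', O i i' * x i' : ℕ) : ℤ) := by
    intro i
    simp only [Y, LinearMap.sum_apply, ← hp.1]
    simp [natVec, mul_add]
  have hP : ∀ i, P i (natVec fun i => (p i).1, natVec fun i => (p i).2) = ((p i).1 : ℤ) :=
    fun i => rfl
  simp only [hY, hP, LinearMap.comp_apply, LinearMap.fst_apply, total_natVec, hp.2]
  have hf : ∀ i, ((q ^ 2) ^ ∑ i', O i i' * x i') ^ (p i).1 *
      q ^ (((p i).1 : ℤ) ^ 2 - (p i).1) * (qp (x i) / (qp (p i).1 * qp (p i).2)) =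
      (q ^ (((p i).1 : ℤ) ^ 2) * q ^ (2 * (((∑ i', O i i' * x i' : ℕ) : ℤ) * (p i).1))) *
        (q ^ (p i).1)⁻¹ * (qp (x i) / (qp (p i).1 * qp (p i).2)) := by
    intro i
    have e : (2 : ℤ) * (((∑ i', O i i' * x i' : ℕ) : ℤ) * (p i).1) =
        ((2 * (∑ i', O i i' * x i') * (p i).1 : ℕ) : ℤ) := by
      push_cast; ring
    rw [zpow_sub₀ q_ne_zero, e, zpow_natCast, zpow_natCast, ← pow_mul, ← pow_mul]
    ring
  simp only [hf, prod_mul_distrib, prod_inv_distrib, prod_pow_eq_pow_sum, hp.2, prod_div_distrib]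
  rw [zpow_sub₀ q_ne_zero, zpow_natCast]
  have := zpow_ne_zero ((h : ℤ) ^ 2) q_ne_zero
  field_simp
theorem sum_piAntidiag_sumElim {ι κ : Type*} [Fintype ι] [Fintype κ] [DecidableEq ι]
    [DecidableEq κ] {E : Type*} [AddCommMonoid E] (n : ℕ) (f : (ι ⊕ κ → ℕ) → E) :
    ∑ z ∈ piAntidiag univ n, f z =
      ∑ p ∈ antidiagonal n, ∑ x ∈ piAntidiag univ p.1, ∑ y ∈ piAntidiag univ p.2,
        f (Sum.elim x y) := by
  simp_rw [← sum_product']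
  rw [sum_sigma']
  refine sum_bij'
    (fun z _ => ⟨(∑ i, z (.inl i), ∑ i, z (.inr i)), (fun i => z (.inl i), fun i => z (.inr i))⟩)
    (fun t _ => Sum.elim t.2.1 t.2.2) ?_ ?_ ?_ ?_ ?_
  · simp
  · rintro ⟨⟨k, l⟩, x, y⟩ h
    simp only [mem_sigma, mem_product, mem_piAntidiag, HasAntidiagonal.mem_antidiagonal] at h
    simp [h.2.1.1, h.2.2.1, h.1]
  · intro z _
    exact Sum.elim_comp_inl_inr z
  · rintro ⟨⟨k, l⟩, x, y⟩ h
    simp only [mem_sigma, mem_product, mem_piAntidiag] at h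
    obtain ⟨_, ⟨rfl, _⟩, rfl, _⟩ := h
    rfl
  · intro z _
    rw [← Sum.elim_comp_inl_inr z]
    rfl

theorem sum_piAntidiag_split {ι : Type*} [Fintype ι] [DecidableEq ι]
    {E : Type*} [AddCommMonoid E] (h l : ℕ) (f : (ι → ℕ × ℕ) → E) :
    ∑ x ∈ piAntidiag univ (h + l),
        ∑ p ∈ (Fintype.piFinset fun i : ι => antidiagonal (x i)).filter
          (fun p => ∑ i, (p i).1 = h), f p =
      ∑ α ∈ piAntidiag univ h, ∑ β ∈ piAntidiag univ l, f fun i => (α i, β i) := by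
  rw [sum_sigma', ← sum_product']
  refine sum_bij' (fun t _ => (fun i => (t.2 i).1, fun i => (t.2 i).2))
    (fun t _ => ⟨t.1 + t.2, fun i => (t.1 i, t.2 i)⟩) ?_ ?_ ?_ ?_ ?_
  · rintro ⟨x, p⟩ ht
    simp only [mem_sigma, mem_piAntidiag, mem_filter, Fintype.mem_piFinset,
      HasAntidiagonal.mem_antidiagonal] at ht
    obtain ⟨⟨hx, _⟩, hp, hh⟩ := ht
    simp only [← hp, sum_add_distrib, hh] at hx
    simpa [hh] using hx
  · rintro ⟨α, β⟩ ht
    simp only [mem_product, mem_piAntidiag] at ht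
    simp [sum_add_distrib, ht.1.1, ht.2.1]
  · rintro ⟨x, p⟩ ht
    simp only [mem_sigma, mem_piAntidiag, mem_filter, Fintype.mem_piFinset,
      HasAntidiagonal.mem_antidiagonal] at ht
    obtain rfl : x = fun i => (p i).1 + (p i).2 := funext fun i => (ht.2.1 i).symm
    rfl
  · simp
  · simp

/-- Splitting every summation variable in two by the quantum Vandermonde identity. -/
theorem exists_split_weight (ι : Type*) [Fintype ι] [DecidableEq ι] :
    ∃ V : (ι → ℤ) × (ι → ℤ) → F, IsQuadraticWeight V ∧ ∀ (h l : ℕ) (G : (ι → ℤ) → F),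
      ∑ x ∈ piAntidiag (univ : Finset ι) (h + l),
          G (natVec x) / (∏ i, qp (x i)) * (qp (h + l) / (qp h * qp l)) =
        ∑ α ∈ piAntidiag univ h, ∑ β ∈ piAntidiag univ l,
          G (natVec α + natVec β) * V (natVec α, natVec β) /
            ((∏ i, qp (α i)) * ∏ i, qp (β i)) := by
  obtain ⟨V, hV, hx⟩ := exists_vandermonde_weight ι
  refine ⟨V, hV, fun h l G => ?_⟩
  refine Eq.trans ?_ (sum_piAntidiag_split h l fun p =>
    G ((natVec fun i => (p i).1) + natVec fun i => (p i).2) *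
      V (natVec fun i => (p i).1, natVec fun i => (p i).2) /
        ((∏ i, qp (p i).1) * ∏ i, qp (p i).2))
  refine sum_congr rfl fun x hxmem => ?_
  have hsum : ∑ i, x i = h + l := (mem_piAntidiag.mp hxmem).1
  have hx := hx x h
  rw [hsum, gaussBinom_add] at hx
  rw [div_mul_eq_mul_div, mul_div_assoc, hx, mul_sum]
  refine sum_congr rfl fun p hp => ?_
  simp only [mem_filter, Fintype.mem_piFinset, HasAntidiagonal.mem_antidiagonal] at hp
  have hG : natVec x = (natVec fun i => (p i).1) + natVec fun i => (p i).2 := by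
    ext i
    simp [natVec, ← hp.1 i]
  rw [hG, mul_div_assoc]

/-- The quiver sum with `k` units on active variables and `l` units on inactive variables. -/
def quiverSum {ι κ : Type*} [Fintype ι] [Fintype κ] [DecidableEq ι] [DecidableEq κ]
    (W : (ι → ℤ) × (κ → ℤ) → F) (k l : ℕ) : F :=
  ∑ x ∈ piAntidiag univ k, ∑ y ∈ piAntidiag univ l,
    W (natVec x, natVec y) / ((∏ i, qp (x i)) * ∏ i, qp (y i))

/-- A family of vectors of the shape in the theorem, with the summation variables separated into
active ones, summing to `k`, and inactive ones, summing to `j - k`. -/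
def HasQuiverForm (v : (j : ℕ) → Fin (j + 1) → F) : Prop :=
  ∃ (ι κ : Type) (_ : Fintype ι) (_ : Fintype κ) (_ : DecidableEq ι) (_ : DecidableEq κ),
    Nonempty (ι ⊕ κ) ∧ ∃ W : (ι → ℤ) × (κ → ℤ) → F, IsQuadraticWeight W ∧
      ∀ (j : ℕ) (k : Fin (j + 1)), v j k = qp k * qp (j - k) * quiverSum W k (j - k)

theorem hasQuiverForm_e0 : HasQuiverForm e0 := by
  refine ⟨Empty, Unit, inferInstance, inferInstance, inferInstance, inferInstance, inferInstance,
    _, .one, fun j k => ?_⟩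
  have hU (l : ℕ) : piAntidiag (univ : Finset Unit) l = {fun _ => l} := by
    ext f
    rw [mem_singleton, mem_piAntidiag, funext_iff, Unique.forall_iff]
    simp [Unique.forall_iff (α := Unit)]
  obtain ⟨k, hk⟩ := k
  simp only [quiverSum, hU]
  cases k with
  | zero =>
    have := qp_ne_zero j
    have h0 : qp 0 = 1 := by simp [qp, qPoch]
    simp [e0, h0, this]
  | succ k => simp [e0]

theorem sum_range_eq_sum_antidiagonal_left {E : Type*} [AddCommMonoid E] (h m : ℕ) (f : ℕ → E)
    (hf : ∀ k, h < k → f k = 0) :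
    ∑ k ∈ range (h + m + 1), f k = ∑ p ∈ antidiagonal h, f p.1 := by
  rw [Nat.sum_antidiagonal_eq_sum_range_succ_mk, add_right_comm, sum_range_add,
    sum_eq_zero fun k _ => hf (h + 1 + k) (by omega), add_zero]

theorem sum_range_eq_sum_antidiagonal_right {E : Type*} [AddCommMonoid E] (h m : ℕ) (f : ℕ → E)
    (hf : ∀ k < h, f k = 0) :
    ∑ k ∈ range (h + m + 1), f k = ∑ p ∈ antidiagonal m, f (h + p.1) := by
  rw [Nat.sum_antidiagonal_eq_sum_range_succ_mk, add_assoc, sum_range_add,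
    sum_eq_zero fun k hk => hf k (mem_range.mp hk), zero_add]

theorem HasQuiverForm.stepVec_T {v : (j : ℕ) → Fin (j + 1) → F} (hv : HasQuiverForm v)
    (X : TangleType) : HasQuiverForm fun j => stepVec Letter.T X j (v j) := by
  obtain ⟨ι, κ, _, _, _, _, _, W, hW, hv⟩ := hv
  obtain ⟨C, hC, hcoef⟩ := exists_weight_coef_T X
  obtain ⟨V, hV, hsplit⟩ := exists_split_weight κ
  let Lx : (ι ⊕ κ → ℤ) × (κ → ℤ) →ₗ[ℤ] (ι → ℤ) :=
    LinearMap.funLeft ℤ ℤ Sum.inl ∘ₗ LinearMap.fst ℤ _ _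
  let Lα : (ι ⊕ κ → ℤ) × (κ → ℤ) →ₗ[ℤ] (κ → ℤ) :=
    LinearMap.funLeft ℤ ℤ Sum.inr ∘ₗ LinearMap.fst ℤ _ _
  let Lβ : (ι ⊕ κ → ℤ) × (κ → ℤ) →ₗ[ℤ] (κ → ℤ) := LinearMap.snd ℤ _ _
  let k' := total ι ∘ₗ Lx
  let h' := k' + total κ ∘ₗ Lα
  refine ⟨ι ⊕ κ, κ, inferInstance, inferInstance, inferInstance, inferInstance, inferInstance,
    _, ((hC.comp ((h' + total κ ∘ₗ Lβ).prod (k'.prod h'))).mul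
      (hW.comp (Lx.prod (Lα + Lβ)))).mul (hV.comp (Lα.prod Lβ)), ?_⟩
  rintro j ⟨h, hh⟩
  obtain ⟨m, rfl⟩ : ∃ m, j = h + m := ⟨j - h, by omega⟩
  simp only [stepVec, hcoef, hv, Nat.add_sub_cancel_left]
  rw [Fin.sum_univ_eq_sum_range (fun k => qp k * qp (h + m - k) * quiverSum W k (h + m - k) *
    if k ≤ h ∧ h ≤ h + m then C (((h + m : ℕ) : ℤ), (k : ℤ), (h : ℤ)) * qbin h k else 0),
    sum_range_eq_sum_antidiagonal_left _ _ _ (fun k hk => by rw [if_neg (by omega), mul_zero]),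
    quiverSum, sum_piAntidiag_sumElim, mul_sum]
  refine sum_congr rfl fun p hp => ?_
  obtain ⟨k, l⟩ := p
  obtain rfl : k + l = h := by simpa using hp
  rw [if_pos (by omega), show k + l + m - k = l + m by omega, quiverSum]
  have hfac : ∀ z c : F, qp k * qp (l + m) * z * (c * qbin (k + l) k) =
      qp (k + l) * qp m * (c * (z * (qp (l + m) / (qp l * qp m)))) := by
    intro z c
    have := qp_ne_zero k
    have := qp_ne_zero l
    have := qp_ne_zero m
    rw [qbin, Nat.add_sub_cancel_left]
    field_simp
  rw [hfac, sum_mul, mul_sum]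
  congr 1
  refine sum_congr rfl fun x hx => ?_
  have hs := hsplit l m fun y => W (natVec x, y) / ∏ i, qp (x i)
  simp only [div_div] at hs
  rw [sum_mul, hs, mul_sum]
  refine sum_congr rfl fun α hα => ?_
  rw [mul_sum]
  refine sum_congr rfl fun β hβ => ?_
  have hLx : Lx (natVec (Sum.elim x α), natVec β) = natVec x := rfl
  have hLα : Lα (natVec (Sum.elim x α), natVec β) = natVec α := rfl
  have hLβ : Lβ (natVec (Sum.elim x α), natVec β) = natVec β := rfl
  simp only [LinearMap.prod_apply, Function.prod, LinearMap.add_apply, LinearMap.comp_apply, h', k', hLx,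
    hLα, hLβ, total_natVec, (mem_piAntidiag.mp hx).1, (mem_piAntidiag.mp hα).1,
    (mem_piAntidiag.mp hβ).1, Fintype.prod_sum_type, Sum.elim_inl, Sum.elim_inr]
  push_cast
  simp only [div_eq_mul_inv, mul_inv]
  ring

theorem HasQuiverForm.stepVec_R {v : (j : ℕ) → Fin (j + 1) → F} (hv : HasQuiverForm v)
    (X : TangleType) : HasQuiverForm fun j => stepVec Letter.R X j (v j) := by
  obtain ⟨ι, κ, _, _, _, _, _, W, hW, hv⟩ := hv
  obtain ⟨C, hC, hcoef⟩ := exists_weight_coef_R X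
  obtain ⟨V, hV, hsplit⟩ := exists_split_weight ι
  let Lα : (ι → ℤ) × (ι ⊕ κ → ℤ) →ₗ[ℤ] (ι → ℤ) := LinearMap.fst ℤ _ _
  let Lβ : (ι → ℤ) × (ι ⊕ κ → ℤ) →ₗ[ℤ] (ι → ℤ) :=
    LinearMap.funLeft ℤ ℤ Sum.inl ∘ₗ LinearMap.snd ℤ _ _
  let Ly : (ι → ℤ) × (ι ⊕ κ → ℤ) →ₗ[ℤ] (κ → ℤ) :=
    LinearMap.funLeft ℤ ℤ Sum.inr ∘ₗ LinearMap.snd ℤ _ _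
  let h' := total ι ∘ₗ Lα
  let k' := h' + total ι ∘ₗ Lβ
  refine ⟨ι, ι ⊕ κ, inferInstance, inferInstance, inferInstance, inferInstance, inferInstance,
    _, ((hC.comp ((k' + total κ ∘ₗ Ly).prod (k'.prod h'))).mul
      (hW.comp ((Lα + Lβ).prod Ly))).mul (hV.comp (Lα.prod Lβ)), ?_⟩
  rintro j ⟨h, hh⟩
  obtain ⟨m, rfl⟩ : ∃ m, j = h + m := ⟨j - h, by omega⟩
  simp only [stepVec, hcoef, hv, Nat.add_sub_cancel_left]
  rw [Fin.sum_univ_eq_sum_range (fun k => qp k * qp (h + m - k) * quiverSum W k (h + m - k) *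
    if h ≤ k then C (((h + m : ℕ) : ℤ), (k : ℤ), (h : ℤ)) * qbin m (k - h) else 0),
    sum_range_eq_sum_antidiagonal_right _ _ _ (fun k hk => by rw [if_neg (by omega), mul_zero]),
    quiverSum]
  simp only [sum_piAntidiag_sumElim]
  rw [sum_comm, mul_sum]
  refine sum_congr rfl fun p hp => ?_
  obtain ⟨l, r⟩ := p
  obtain rfl : l + r = m := by simpa using hp
  rw [if_pos (by omega), show h + (l + r) - (h + l) = r by omega, quiverSum, sum_comm]
  have hfac : ∀ z c : F, qp (h + l) * qp r * z * (c * qbin (l + r) l) =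
      qp h * qp (l + r) * (c * (z * (qp (h + l) / (qp h * qp l)))) := by
    intro z c
    have := qp_ne_zero h
    have := qp_ne_zero l
    have := qp_ne_zero r
    rw [qbin, Nat.add_sub_cancel_left]
    field_simp
  rw [Nat.add_sub_cancel_left, hfac, sum_mul, mul_sum]
  congr 1
  simp only [sum_comm (s := piAntidiag (univ : Finset ι) l)]
  rw [sum_comm (s := piAntidiag (univ : Finset ι) h)]
  refine sum_congr rfl fun y hy => ?_
  have hs := hsplit h l fun x => W (x, natVec y) / ∏ i, qp (y i)
  simp only [div_div, mul_comm (∏ i, qp (y i))] at hs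
  rw [sum_mul, hs, mul_sum]
  refine sum_congr rfl fun α hα => ?_
  rw [mul_sum]
  refine sum_congr rfl fun β hβ => ?_
  have hLα : Lα (natVec α, natVec (Sum.elim β y)) = natVec α := rfl
  have hLβ : Lβ (natVec α, natVec (Sum.elim β y)) = natVec β := rfl
  have hLy : Ly (natVec α, natVec (Sum.elim β y)) = natVec y := rfl
  simp only [LinearMap.prod_apply, Function.prod, LinearMap.add_apply, LinearMap.comp_apply, h', k', hLy,
    hLα, hLβ, total_natVec, (mem_piAntidiag.mp hy).1, (mem_piAntidiag.mp hα).1,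
    (mem_piAntidiag.mp hβ).1, Fintype.prod_sum_type, Sum.elim_inl, Sum.elim_inr]
  push_cast
  simp only [div_eq_mul_inv, mul_inv, add_assoc]
  ring

theorem HasQuiverForm.runVec (w : List Letter) (X : TangleType) {v : (j : ℕ) → Fin (j + 1) → F}
    (hv : HasQuiverForm v) : HasQuiverForm fun j => runVec w X j (v j) := by
  induction w generalizing X v with
  | nil => exact hv
  | cons l w ih =>
    cases l
    · exact ih _ (hv.stepVec_T X)
    · exact ih _ (hv.stepVec_R X)
theorem bilin_apply_natVec {n : ℕ} (B : (Fin n → ℤ) →ₗ[ℤ] (Fin n → ℤ) →ₗ[ℤ] ℤ) (d : Fin n → ℕ) :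
    B (natVec d) (natVec d) =
      ∑ i, ∑ i', (d i : ℤ) * B (Pi.single i 1) (Pi.single i' 1) * (d i' : ℤ) := by
  conv_lhs => rw [pi_eq_sum_univ' (natVec d)]
  simp only [map_sum, map_smul, LinearMap.sum_apply, LinearMap.smul_apply, smul_eq_mul, mul_sum,
    natVec]
  rw [sum_comm]
  exact sum_congr rfl fun i _ => sum_congr rfl fun i' _ => by ring

theorem linear_apply_natVec {n : ℕ} (S : (Fin n → ℤ) →ₗ[ℤ] ℤ) (d : Fin n → ℕ) :
    S (natVec d) = ∑ i, S (Pi.single i 1) * (d i : ℤ) := by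
  conv_lhs => rw [pi_eq_sum_univ' (natVec d)]
  simp only [map_sum, map_smul, smul_eq_mul, natVec, mul_comm]

/-- The generating functions of the rescaled skein module evaluations of every rational
tangle can be written in quiver form. -/
theorem rational_tangles_quiver_form (w : List Letter) (hw : w ≠ []) :
    ∃ m n : ℕ, 1 ≤ m + n ∧
      ∃ (Q : Matrix (Fin (m + n)) (Fin (m + n)) ℤ) (S A : Fin (m + n) → ℤ),
        Q.IsSymm ∧
        ∀ (j : ℕ) (k : Fin (j + 1)),
          runVec w TangleType.UP j (e0 j) k * qbin j (k : ℕ) =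
            ∑ d ∈ (Fintype.piFinset fun _ : Fin (m + n) => Finset.range (j + 1)).filter
                (fun d => (∑ i, d i = j) ∧
                  (∑ i ∈ Finset.univ.filter (fun i : Fin (m + n) => (i : ℕ) < m), d i
                    = (k : ℕ))),
              (-q) ^ (∑ i, S i * ((d i : ℕ) : ℤ)) * a ^ (∑ i, A i * ((d i : ℕ) : ℤ)) *
                q ^ (∑ i, ∑ i', ((d i : ℕ) : ℤ) * Q i i' * ((d i' : ℕ) : ℤ)) *
                (qp j / ∏ i, qp (d i)) := by
  obtain ⟨ι, κ, _, _, _, _, hne, W, hW, hv⟩ := hasQuiverForm_e0.runVec w TangleType.UP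
  let m := Fintype.card ι
  let n := Fintype.card κ
  let e : Fin (m + n) ≃ ι ⊕ κ := finSumFinEquiv.symm.trans
    (Equiv.sumCongr (Fintype.equivFin ι).symm (Fintype.equivFin κ).symm)
  have he : ∀ x, ((e.symm x : Fin (m + n)) : ℕ) < m ↔ x.isLeft := by
    rintro (x | y) <;> simp [e, m]
  let L : (Fin (m + n) → ℤ) →ₗ[ℤ] (ι → ℤ) × (κ → ℤ) :=
    (LinearMap.funLeft ℤ ℤ fun x => e.symm (.inl x)).prod
      (LinearMap.funLeft ℤ ℤ fun y => e.symm (.inr y))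
  obtain ⟨S, A, B, hB, hSAB⟩ := hW.comp L
  refine ⟨m, n, ?_, fun i i' => B (Pi.single i 1) (Pi.single i' 1), fun i => S (Pi.single i 1),
    fun i => A (Pi.single i 1), ?_, fun j k => ?_⟩
  · have := Fintype.card_pos_iff.mpr hne
    rwa [Fintype.card_sum] at this
  · ext i i'
    exact hB _ _
  have hsum : ∀ d : Fin (m + n) → ℕ,
      ∑ i, d i = ∑ x, d (e.symm (.inl x)) + ∑ y, d (e.symm (.inr y)) := by
    intro d
    rw [← e.symm.sum_comp, Fintype.sum_sum_type]
  have hsumActive : ∀ d : Fin (m + n) → ℕ,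
      ∑ i ∈ Finset.univ.filter (fun i : Fin (m + n) => (i : ℕ) < m), d i =
        ∑ x, d (e.symm (.inl x)) := by
    intro d
    rw [sum_filter, ← e.symm.sum_comp, Fintype.sum_sum_type]
    simp [he]
  have hprod : ∀ d : Fin (m + n) → ℕ,
      ∏ i, qp (d i) = (∏ x, qp (d (e.symm (.inl x)))) * ∏ y, qp (d (e.symm (.inr y))) := by
    intro d
    rw [← e.symm.prod_comp, Fintype.prod_sum_type]
  have hbin : ∀ z : F, qp k * qp (j - k) * z * qbin j k = qp j * z := by
    intro z
    have := qp_ne_zero k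
    have := qp_ne_zero (j - k)
    rw [qbin]
    field_simp
  have hk : (k : ℕ) ≤ j := by omega
  refine (congrArg (· * qbin j k) (hv j k)).trans ?_
  dsimp only
  rw [hbin, quiverSum, ← sum_product', mul_sum]
  symm
  refine sum_bij' (fun d _ => (fun x => d (e.symm (.inl x)), fun y => d (e.symm (.inr y))))
    (fun t _ => Sum.elim t.1 t.2 ∘ e) ?_ ?_ ?_ ?_ ?_
  · intro d hd
    simp only [mem_filter, hsum, hsumActive] at hd
    simp only [mem_product, mem_piAntidiag, mem_univ, implies_true, and_true]
    omega
  · rintro ⟨x, y⟩ ht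
    simp only [mem_product, mem_piAntidiag, mem_univ, implies_true, and_true] at ht
    have htot : ∑ i, (Sum.elim x y ∘ e) i = j := by
      rw [hsum]
      simp only [Function.comp_apply, Equiv.apply_symm_apply, Sum.elim_inl, Sum.elim_inr]
      exact (congrArg₂ (· + ·) ht.1 ht.2).trans (Nat.add_sub_of_le hk)
    simp only [mem_filter, Fintype.mem_piFinset, mem_range, hsumActive, htot, true_and]
    constructor
    · intro i
      have := single_le_sum (fun i _ => Nat.zero_le ((Sum.elim x y ∘ e) i)) (mem_univ i)
      omega
    · simpa using ht.1
  · intro d _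
    ext i
    obtain ⟨z, rfl⟩ := e.symm.surjective i
    cases z <;> simp
  · rintro ⟨x, y⟩ _
    simp
  · intro d _
    have hW' := hSAB (natVec d)
    rw [bilin_apply_natVec, linear_apply_natVec, linear_apply_natVec] at hW'
    rw [← hW', hprod]
    change W (natVec _, natVec _) * _ = _
    ring
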